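/- For every ε > 0 there exists a sequence of instances (𝒯_n, w_n), where each 𝒯_n is a finite tree and w_n a weight function with w_n(𝒯_n) = 1, such that lim_{n→∞} OPT(𝒯_n, w_n) = ∞ and for every n, every centroid tree C_n of (𝒯_n, w_n) satisfies cost_{w_n}(C_n) ≥ 2·OPT(𝒯_n, w_n) − 1 − ε. -/

import Mathlib

open Filter Topology

universe u

variable {V : Type u}

/-- Rooted trees with vertices labelled by elements of `V`. -/
inductive RTree (V : Type u) : Type u where
  | node : V → List (RTree V) → RTree V

namespace RTree

/-- The root of a rooted tree. -/
def root : RTree V → V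
  | node r _ => r

/-- The subtrees rooted at the children of the root. -/
def children : RTree V → List (RTree V)
  | node _ ts => ts

/-- The list of pairs `(v, path from the root to v)` over all vertices `v` of the tree. -/
def pathsFrom : RTree V → List (V × List V)
  | node r ts =>
      (r, [r]) ::
        (ts.attach.map fun t => (t.1.pathsFrom.map fun p => (p.1, r :: p.2))).flatten
  decreasing_by
    simp only [RTree.node.sizeOf_spec]
    have := List.sizeOf_lt_of_mem t.2
    omega

/-- The vertex set of a rooted tree. -/
def vertSet (T : RTree V) : Set V := {v | ∃ p ∈ T.pathsFrom, p.1 = v}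

/-- `Path_T(v)`: the set of vertices on the path in `T` from the root to `v`
(including both endpoints). -/
def pathSet (T : RTree V) (v : V) : Set V := {x | ∃ p ∈ T.pathsFrom, p.1 = v ∧ x ∈ p.2}

/-- The depth of a vertex `v` in `T`; the root has depth 1. -/
noncomputable def depth (T : RTree V) (v : V) : ℕ := (T.pathSet v).ncard

/-- All subtrees of a rooted tree (including the tree itself). -/
def allSubtrees : RTree V → List (RTree V)
  | node r ts => node r ts :: (ts.attach.map fun t => t.1.allSubtrees).flatten
  decreasing_by
    simp only [RTree.node.sizeOf_spec]
    have := List.sizeOf_lt_of_mem t.2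
    omega

/-- Two rooted trees are equivalent (represent the same search tree) if they have
the same root-to-vertex paths. -/
def Equiv (T₁ T₂ : RTree V) : Prop := ∀ v, T₁.pathSet v = T₂.pathSet v

end RTree

/-- `x` and `y` are joined by a walk of `G` staying inside `s`. -/
def ReachIn (G : SimpleGraph V) (s : Set V) (x y : V) : Prop :=
  ∃ p : G.Walk x y, ∀ v ∈ p.support, v ∈ s

/-- The connected component of `x` in the subgraph of `G` induced by `s`. -/
def compIn (G : SimpleGraph V) (s : Set V) (x : V) : Set V := {y | ReachIn G s x y}

/-- The set of connected components of the subgraph of `G` induced by `s`. -/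
def comps (G : SimpleGraph V) (s : Set V) : Set (Set V) := {c | ∃ x ∈ s, c = compIn G s x}

/-- `s` induces a (nonempty) connected subgraph of `G`. -/
def ConnIn (G : SimpleGraph V) (s : Set V) : Prop :=
  s.Nonempty ∧ ∀ x ∈ s, ∀ y ∈ s, ReachIn G s x y

/-- The total weight of a set of vertices. -/
noncomputable def wsum (w : V → ℝ) (s : Set V) : ℝ := ∑ᶠ x ∈ s, w x

/-- `IsSearchTree G s T`: `T` is a search tree on the subgraph of `G` induced by `s`.
Its root `r` is a vertex of `s`, its vertex set is `s`, and the subtrees rooted at the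
children of `r` are search trees on the connected components of the induced subgraph
on `s \ {r}` (one subtree for each component). -/
inductive IsSearchTree (G : SimpleGraph V) : Set V → RTree V → Prop where
  | node {s : Set V} {r : V} {ts : List (RTree V)} :
      r ∈ s →
      (RTree.node r ts).vertSet = s →
      (∀ t ∈ ts, IsSearchTree G (compIn G (s \ {r}) t.root) t) →
      ts.Pairwise (fun t₁ t₂ => compIn G (s \ {r}) t₁.root ≠ compIn G (s \ {r}) t₂.root) →
      IsSearchTree G s (RTree.node r ts)

/-- The cost of a search tree: `∑_x w(x) · depth(x)`, the root having depth 1. -/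
noncomputable def cost (w : V → ℝ) (T : RTree V) : ℝ :=
  ∑ᶠ v ∈ T.vertSet, w v * (T.depth v : ℝ)

/-- The optimum cost of a search tree on the subgraph of `G` induced by `s`. -/
noncomputable def OPT (G : SimpleGraph V) (w : V → ℝ) (s : Set V) : ℝ :=
  sInf (cost w '' {T | IsSearchTree G s T})

/-- `v` is an `α`-centroid of the subgraph of `G` induced by `s` (with weights `w`):
every connected component of the induced subgraph on `s \ {v}` has weight at most
`α` times the weight of `s`. -/
def IsAlphaCentroid (G : SimpleGraph V) (w : V → ℝ) (α : ℝ) (s : Set V) (v : V) : Prop :=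
  v ∈ s ∧ ∀ x ∈ s \ {v}, wsum w (compIn G (s \ {v}) x) ≤ α * wsum w s

/-- `v` is a centroid of the subgraph of `G` induced by `s` (with weights `w`). -/
def IsCentroid (G : SimpleGraph V) (w : V → ℝ) (s : Set V) (v : V) : Prop :=
  v ∈ s ∧ ∀ x ∈ s \ {v}, wsum w (compIn G (s \ {v}) x) ≤ wsum w s / 2

/-- `T` is an `α`-centroid tree on the subgraph of `G` induced by `s`. -/
def IsAlphaCentroidTree (G : SimpleGraph V) (w : V → ℝ) (α : ℝ) (s : Set V) (T : RTree V) :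
    Prop :=
  IsSearchTree G s T ∧ ∀ t ∈ T.allSubtrees, IsAlphaCentroid G w α t.vertSet t.root

/-- `T` is a centroid tree on the subgraph of `G` induced by `s`. -/
def IsCentroidTree (G : SimpleGraph V) (w : V → ℝ) (s : Set V) (T : RTree V) : Prop :=
  IsSearchTree G s T ∧ ∀ t ∈ T.allSubtrees, IsCentroid G w t.vertSet t.root

/-- `cent(𝒯,w)`: the maximum cost of a centroid tree. -/
noncomputable def centCost (G : SimpleGraph V) (w : V → ℝ) (s : Set V) : ℝ :=
  sSup (cost w '' {T | IsCentroidTree G w s T})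

/-- `centᵅ(𝒯,w)`: the maximum cost of an `α`-centroid tree (`0` if none exists, since
`sSup ∅ = 0` in `ℝ`). -/
noncomputable def centCostA (G : SimpleGraph V) (w : V → ℝ) (α : ℝ) (s : Set V) : ℝ :=
  sSup (cost w '' {T | IsAlphaCentroidTree G w α s T})

/-- `b` is a child of `a` in the rooted tree `T`. -/
def ChildRel (T : RTree V) (a b : V) : Prop :=
  ∃ t ∈ T.allSubtrees, t.root = a ∧ ∃ t' ∈ t.children, t'.root = b


namespace RTree

theorem mem_pathsFrom_node {r : V} {ts : List (RTree V)} {p : V × List V} :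
    p ∈ (node r ts).pathsFrom ↔
      p = (r, [r]) ∨ ∃ t ∈ ts, ∃ q ∈ t.pathsFrom, (q.1, r :: q.2) = p := by
  rw [pathsFrom]
  simp only [List.mem_cons, List.mem_flatten, List.mem_map, List.mem_attach, true_and,
    Subtype.exists]
  constructor
  · rintro (h | ⟨_, ⟨t, ht, rfl⟩, hp⟩)
    · exact Or.inl h
    · exact Or.inr ⟨t, ht, by simpa using hp⟩
  · rintro (h | ⟨t, ht, hp⟩)
    · exact Or.inl h
    · exact Or.inr ⟨_, ⟨t, ht, rfl⟩, by simpa using hp⟩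

theorem mem_allSubtrees_node {r : V} {ts : List (RTree V)} {t' : RTree V} :
    t' ∈ (node r ts).allSubtrees ↔ t' = node r ts ∨ ∃ t ∈ ts, t' ∈ t.allSubtrees := by
  rw [allSubtrees]
  simp only [List.mem_cons, List.mem_flatten, List.mem_map, List.mem_attach, true_and,
    Subtype.exists]
  constructor
  · rintro (h | ⟨_, ⟨t, ht, rfl⟩, hp⟩)
    · exact Or.inl h
    · exact Or.inr ⟨t, ht, hp⟩
  · rintro (h | ⟨t, ht, hp⟩)
    · exact Or.inl h
    · exact Or.inr ⟨_, ⟨t, ht, rfl⟩, hp⟩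

theorem mem_vertSet_node {r : V} {ts : List (RTree V)} {v : V} :
    v ∈ (node r ts).vertSet ↔ v = r ∨ ∃ t ∈ ts, v ∈ t.vertSet := by
  simp only [vertSet, Set.mem_ofPred_eq, mem_pathsFrom_node]
  constructor
  · rintro ⟨p, rfl | ⟨t, ht, q, hq, rfl⟩, rfl⟩
    · exact Or.inl rfl
    · exact Or.inr ⟨t, ht, q, hq, rfl⟩
  · rintro (rfl | ⟨t, ht, q, hq, rfl⟩)
    · exact ⟨_, Or.inl rfl, rfl⟩
    · exact ⟨_, Or.inr ⟨t, ht, q, hq, rfl⟩, rfl⟩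

theorem root_mem_vertSet (T : RTree V) : T.root ∈ T.vertSet := by
  cases T
  exact mem_vertSet_node.2 (Or.inl rfl)

theorem mem_allSubtrees_self (T : RTree V) : T ∈ T.allSubtrees := by
  cases T
  exact mem_allSubtrees_node.2 (Or.inl rfl)

theorem pathSet_finite (T : RTree V) (v : V) : (T.pathSet v).Finite := by
  have h : T.pathSet v ⊆ ⋃ p ∈ {p | p ∈ T.pathsFrom}, {x | x ∈ p.2} := by
    rintro x ⟨p, hp, -, hx⟩
    exact Set.mem_biUnion (x := p) hp hx
  exact ((List.finite_toSet T.pathsFrom).biUnion fun p _ => List.finite_toSet p.2).subset h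

end RTree

section Connectivity

variable {G : SimpleGraph V} {s : Set V} {x y z : V}

theorem ReachIn.refl (hx : x ∈ s) : ReachIn G s x x :=
  ⟨SimpleGraph.Walk.nil, by simpa using hx⟩

theorem ReachIn.symm (h : ReachIn G s x y) : ReachIn G s y x := by
  obtain ⟨p, hp⟩ := h
  exact ⟨p.reverse, by simpa using hp⟩

theorem ReachIn.trans (h : ReachIn G s x y) (h' : ReachIn G s y z) : ReachIn G s x z := by
  obtain ⟨p, hp⟩ := h
  obtain ⟨q, hq⟩ := h'
  refine ⟨p.append q, fun v hv => ?_⟩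
  rw [SimpleGraph.Walk.mem_support_append_iff] at hv
  exact hv.elim (hp v) (hq v)

theorem ReachIn.of_adj (h : G.Adj x y) (hx : x ∈ s) (hy : y ∈ s) : ReachIn G s x y :=
  ⟨h.toWalk, by simp [hx, hy]⟩

theorem ReachIn.mono {t : Set V} (hst : s ⊆ t) (h : ReachIn G s x y) : ReachIn G t x y :=
  let ⟨p, hp⟩ := h
  ⟨p, fun v hv => hst (hp v hv)⟩

theorem ReachIn.left_mem (h : ReachIn G s x y) : x ∈ s :=
  let ⟨p, hp⟩ := h
  hp x p.start_mem_support

theorem ReachIn.right_mem (h : ReachIn G s x y) : y ∈ s := h.symm.left_mem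

/-- A walk in `s` starting in `Q` stays in `Q` if no edge inside `s` leaves `Q`. -/
theorem ReachIn.mem_of_closed {Q : Set V}
    (hQ : ∀ a ∈ s, ∀ b ∈ s, G.Adj a b → a ∈ Q → b ∈ Q)
    (h : ReachIn G s x y) (hx : x ∈ Q) : y ∈ Q := by
  obtain ⟨p, hp⟩ := h
  induction p with
  | nil => exact hx
  | cons hadj p ih =>
    simp only [SimpleGraph.Walk.support_cons, List.mem_cons, forall_eq_or_imp] at hp
    exact ih (hQ _ hp.1 _ (hp.2 _ p.start_mem_support) hadj hx) hp.2

theorem ConnIn.subset_of_closed {Q : Set V} (hs : ConnIn G s)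
    (hQ : ∀ a ∈ s, ∀ b ∈ s, G.Adj a b → a ∈ Q → b ∈ Q) (hx : x ∈ s) (hxQ : x ∈ Q) : s ⊆ Q :=
  fun y hy => (hs.2 x hx y hy).mem_of_closed hQ hxQ

theorem compIn_subset : compIn G s x ⊆ s := fun _ h => ReachIn.right_mem h

theorem mem_compIn_self (hx : x ∈ s) : x ∈ compIn G s x := ReachIn.refl hx

theorem compIn_eq_of_mem (h : y ∈ compIn G s x) : compIn G s y = compIn G s x := by
  ext z
  exact ⟨fun hz => ReachIn.trans h hz, fun hz => (ReachIn.symm h).trans hz⟩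

theorem connIn_compIn (hx : x ∈ s) : ConnIn G (compIn G s x) := by
  have key : ∀ y, ReachIn G s x y → ReachIn G (compIn G s x) x y := by
    intro y hy
    refine (ReachIn.mem_of_closed (Q := {y | ReachIn G (compIn G s x) x y}) ?_ hy
      (ReachIn.refl (mem_compIn_self hx)))
    intro a ha b hb hab hQ
    have ha' : a ∈ compIn G s x := ReachIn.right_mem hQ
    exact hQ.trans (ReachIn.of_adj hab ha' (ReachIn.trans ha' (ReachIn.of_adj hab ha hb)))
  exact ⟨⟨x, mem_compIn_self hx⟩, fun y hy z hz => (key y hy).symm.trans (key z hz)⟩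

theorem ConnIn.subset_compIn {t : Set V} (ht : ConnIn G t) (hts : t ⊆ s) (hx : x ∈ t) :
    t ⊆ compIn G s x :=
  fun y hy => (ht.2 x hx y hy).mono hts

/-- A connected set that no edge inside `s` leaves is a connected component. -/
theorem compIn_eq_of_closed {t : Set V} (ht : ConnIn G t) (hts : t ⊆ s)
    (hclosed : ∀ a ∈ s, ∀ b ∈ s, G.Adj a b → a ∈ t → b ∈ t) (hx : x ∈ t) :
    compIn G s x = t :=
  Set.Subset.antisymm (fun _ hy => ReachIn.mem_of_closed hclosed hy hx)
    (ht.subset_compIn hts hx)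

end Connectivity

section SearchTree

variable {G : SimpleGraph V} {s : Set V}

theorem IsSearchTree.vertSet_eq {T : RTree V} (h : IsSearchTree G s T) : T.vertSet = s := by
  cases h
  assumption

theorem IsSearchTree.pathSet_subset {T : RTree V} (h : IsSearchTree G s T) (v : V) :
    T.pathSet v ⊆ s := by
  induction h generalizing v with
  | @node s r ts hr hs hts hpw ih =>
    rintro x ⟨p, hp, rfl, hx⟩
    rw [RTree.mem_pathsFrom_node] at hp
    obtain rfl | ⟨t, ht, q, hq, rfl⟩ := hp
    · simp only [List.mem_singleton] at hx
      exact hx ▸ hr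
    · obtain rfl | hx := List.mem_cons.1 hx
      · exact hr
      · exact (compIn_subset (ih t ht q.1 ⟨q, hq, rfl, hx⟩)).1

theorem IsSearchTree.depth_root {r : V} {ts : List (RTree V)}
    (h : IsSearchTree G s (RTree.node r ts)) : (RTree.node r ts).depth r = 1 := by
  cases h with
  | node hr hs hts hpw =>
  have : (RTree.node r ts).pathSet r = {r} := by
    ext x
    constructor
    · rintro ⟨p, hp, hpr, hx⟩
      rw [RTree.mem_pathsFrom_node] at hp
      obtain rfl | ⟨t, ht, q, hq, rfl⟩ := hp
      · simpa using hx
      · exfalso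
        have : q.1 ∈ t.vertSet := ⟨q, hq, rfl⟩
        rw [(hts t ht).vertSet_eq] at this
        exact (compIn_subset this).2 hpr
    · rintro rfl
      exact ⟨(x, [x]), RTree.mem_pathsFrom_node.2 (Or.inl rfl), rfl, by simp⟩
  rw [RTree.depth, this, Set.ncard_singleton]

theorem IsSearchTree.exists_child {r x : V} {ts : List (RTree V)}
    (h : IsSearchTree G s (RTree.node r ts)) (hx : x ∈ s \ {r}) :
    ∃ t ∈ ts, IsSearchTree G (compIn G (s \ {r}) x) t ∧
      ∀ y ∈ compIn G (s \ {r}) x, (RTree.node r ts).depth y = t.depth y + 1 := by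
  cases h with
  | node hr hs hts hpw =>
  have hx' := hx.1
  rw [← hs, RTree.mem_vertSet_node] at hx'
  obtain ⟨t, ht, hxt⟩ := hx'.resolve_left hx.2
  have htt := hts t ht
  rw [htt.vertSet_eq] at hxt
  rw [← compIn_eq_of_mem hxt] at htt
  refine ⟨t, ht, htt, fun y hy => ?_⟩
  have hyt := hy
  rw [compIn_eq_of_mem hxt] at hyt
  have : (RTree.node r ts).pathSet y = insert r (t.pathSet y) := by
    ext z
    constructor
    · rintro ⟨p, hp, rfl, hz⟩
      rw [RTree.mem_pathsFrom_node] at hp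
      obtain rfl | ⟨t', ht', q, hq, rfl⟩ := hp
      · exact absurd rfl (compIn_subset hy).2
      · have hqt : q.1 ∈ t'.vertSet := ⟨q, hq, rfl⟩
        rw [(hts t' ht').vertSet_eq] at hqt
        have heq : compIn G (s \ {r}) t.root = compIn G (s \ {r}) t'.root :=
          (compIn_eq_of_mem hyt).symm.trans (compIn_eq_of_mem hqt)
        obtain rfl : t = t' := by
          by_contra hne
          have : Std.Symm fun t₁ t₂ : RTree V =>
              compIn G (s \ {r}) t₁.root ≠ compIn G (s \ {r}) t₂.root := ⟨fun _ _ h => h.symm⟩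
          exact hpw.forall ht ht' hne heq
        obtain rfl | hz := List.mem_cons.1 hz
        · exact Set.mem_insert _ _
        · exact Set.mem_insert_of_mem _ ⟨q, hq, rfl, hz⟩
    · have hyv : y ∈ t.vertSet := by rwa [htt.vertSet_eq]
      rintro (rfl | ⟨q, hq, rfl, hz⟩)
      · obtain ⟨q, hq, rfl⟩ := hyv
        exact ⟨_, RTree.mem_pathsFrom_node.2 (Or.inr ⟨t, ht, q, hq, rfl⟩), rfl, by simp⟩
      · exact ⟨_, RTree.mem_pathsFrom_node.2 (Or.inr ⟨t, ht, q, hq, rfl⟩), rfl,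
          List.mem_cons_of_mem _ hz⟩
  rw [RTree.depth, this, Set.ncard_insert_of_notMem _ (t.pathSet_finite y), RTree.depth]
  exact fun hrt => (compIn_subset (htt.pathSet_subset y hrt)).2 rfl

theorem IsSearchTree.one_le_depth {T : RTree V} (h : IsSearchTree G s T) {x : V} (hx : x ∈ s) :
    1 ≤ T.depth x := by
  obtain ⟨r, ts⟩ := T
  by_cases hxr : x = r
  · subst hxr
    exact h.depth_root.ge
  · obtain ⟨t, -, -, hd⟩ := h.exists_child ⟨hx, hxr⟩
    rw [hd x (mem_compIn_self ⟨hx, hxr⟩)]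
    omega

/-- `f` attains its minimum exactly once on each connected subset of `s`. -/
def IsRanking (G : SimpleGraph V) (s : Set V) (f : V → ℕ) : Prop :=
  ∀ S ⊆ s, ConnIn G S → ∃ x ∈ S, ∀ y ∈ S, y ≠ x → f x < f y

theorem IsSearchTree.isRanking_depth {T : RTree V} (h : IsSearchTree G s T) :
    IsRanking G s T.depth := by
  intro S hS hconn
  induction hT : sizeOf T using Nat.strong_induction_on generalizing s T with
  | _ n ih =>
  obtain ⟨r, ts⟩ := T
  by_cases hr : r ∈ S
  · refine ⟨r, hr, fun y hy hyr => ?_⟩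
    obtain ⟨t, ht, htt, hd⟩ := h.exists_child ⟨hS hy, hyr⟩
    have hyc := mem_compIn_self (G := G) (show y ∈ s \ {r} from ⟨hS hy, hyr⟩)
    have := htt.one_le_depth hyc
    rw [h.depth_root, hd y hyc]
    omega
  · obtain ⟨x, hx⟩ := hconn.1
    have hS' : S ⊆ s \ {r} := fun y hy => ⟨hS hy, fun h => hr (h ▸ hy)⟩
    obtain ⟨t, ht, htt, hd⟩ := h.exists_child (hS' hx)
    have hSc := hconn.subset_compIn hS' hx
    have hlt : sizeOf t < n := by
      have := List.sizeOf_lt_of_mem ht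
      simp only [RTree.node.sizeOf_spec] at hT
      omega
    obtain ⟨z, hz, hmin⟩ := ih _ hlt htt hSc rfl
    refine ⟨z, hz, fun y hy hyz => ?_⟩
    rw [hd y (hSc hy), hd z (hSc hz)]
    exact Nat.succ_lt_succ (hmin y hy hyz)

theorem IsRanking.mono {f : V → ℕ} {t : Set V} (h : IsRanking G s f) (hts : t ⊆ s) :
    IsRanking G t f :=
  fun S hS => h S (hS.trans hts)

theorem IsRanking.pred {f : V → ℕ} (h : IsRanking G s f) (hf : ∀ x ∈ s, 1 ≤ f x) :
    IsRanking G s fun x => f x - 1 := by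
  intro S hS hconn
  obtain ⟨x, hx, hmin⟩ := h S hS hconn
  refine ⟨x, hx, fun y hy hyx => ?_⟩
  have := hmin y hy hyx
  have := hf x (hS hx)
  show f x - 1 < f y - 1
  omega

theorem IsRanking.exists_isSearchTree {f : V → ℕ} (hfin : s.Finite) (hs : ConnIn G s)
    (h : IsRanking G s f) (hf : ∀ x ∈ s, 1 ≤ f x) :
    ∃ T, IsSearchTree G s T ∧ ∀ x ∈ s, T.depth x ≤ f x := by
  classical
  induction hn : s.ncard using Nat.strong_induction_on generalizing s f with
  | _ n ih =>
  obtain ⟨r, hr, hmin⟩ := h s subset_rfl hs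
  have key : ∀ c ∈ comps G (s \ {r}), ∃ t, IsSearchTree G c t ∧ ∀ x ∈ c, t.depth x ≤ f x - 1 := by
    rintro _ ⟨x, hx, rfl⟩
    have hsub : compIn G (s \ {r}) x ⊆ s := compIn_subset.trans Set.sdiff_subset
    refine ih _ ?_ (hfin.subset hsub) (connIn_compIn hx) ((h.mono hsub).pred fun y hy =>
      hf y (hsub hy)) (fun y hy => ?_) rfl
    · rw [← hn]
      exact Set.ncard_lt_ncard ⟨hsub, fun hss => (compIn_subset (hss hr)).2 rfl⟩ hfin
    · have := hmin y (hsub hy) (compIn_subset hy).2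
      have := hf r hr
      omega
  have : Nonempty (RTree V) := ⟨.node r []⟩
  choose! t ht htf using key
  have hcfin : (comps G (s \ {r})).Finite := by
    refine (hfin.finite_subsets).subset ?_
    rintro _ ⟨x, -, rfl⟩
    exact compIn_subset.trans Set.sdiff_subset
  have hroot : ∀ c ∈ comps G (s \ {r}), compIn G (s \ {r}) (t c).root = c := by
    intro c hc
    have hm := (t c).root_mem_vertSet
    rw [(ht c hc).vertSet_eq] at hm
    obtain ⟨x, hx, rfl⟩ := hc
    exact compIn_eq_of_mem hm
  have hT : IsSearchTree G s (RTree.node r (hcfin.toFinset.toList.map t)) := by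
    refine IsSearchTree.node hr ?_ ?_ ?_
    · ext y
      simp only [RTree.mem_vertSet_node, List.mem_map, Finset.mem_toList, Set.Finite.mem_toFinset]
      constructor
      · rintro (rfl | ⟨_, ⟨c, hc, rfl⟩, hy⟩)
        · exact hr
        · rw [(ht c hc).vertSet_eq] at hy
          obtain ⟨x, hx, rfl⟩ := hc
          exact (compIn_subset hy).1
      · intro hy
        by_cases hyr : y = r
        · exact Or.inl hyr
        · have hc : compIn G (s \ {r}) y ∈ comps G (s \ {r}) := ⟨y, ⟨hy, hyr⟩, rfl⟩
          refine Or.inr ⟨_, ⟨_, hc, rfl⟩, ?_⟩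
          rw [(ht _ hc).vertSet_eq]
          exact mem_compIn_self ⟨hy, hyr⟩
    · intro t' ht'
      simp only [List.mem_map, Finset.mem_toList, Set.Finite.mem_toFinset] at ht'
      obtain ⟨c, hc, rfl⟩ := ht'
      rw [hroot c hc]
      exact ht c hc
    · rw [List.pairwise_map]
      refine List.Pairwise.imp_of_mem ?_ (Finset.nodup_toList hcfin.toFinset)
      intro c c' hc hc' hne
      simp only [Finset.mem_toList, Set.Finite.mem_toFinset] at hc hc'
      rwa [hroot c hc, hroot c' hc']
  refine ⟨_, hT, fun x hx => ?_⟩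
  by_cases hxr : x = r
  · subst hxr
    rw [hT.depth_root]
    exact hf x hx
  · have hx' : x ∈ s \ {r} := ⟨hx, hxr⟩
    obtain ⟨t', ht', htt, hd⟩ := hT.exists_child hx'
    simp only [List.mem_map, Finset.mem_toList, Set.Finite.mem_toFinset] at ht'
    obtain ⟨c, hc, rfl⟩ := ht'
    have hceq : compIn G (s \ {r}) x = c := htt.vertSet_eq.symm.trans (ht c hc).vertSet_eq
    have hxc : x ∈ c := hceq ▸ mem_compIn_self hx'
    rw [hd x (mem_compIn_self hx')]
    have := htf c hc x hxc
    have := hmin x hx hxr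
    omega

end SearchTree

section BridgeGraph

variable {α β : Type*}

/-- The graph obtained from the disjoint union of `G` and `H` by adding a new vertex `none`
adjacent to `u` and to `v`. -/
def bridgeGraph (G : SimpleGraph α) (H : SimpleGraph β) (u : α) (v : β) :
    SimpleGraph (Option (α ⊕ β)) where
  Adj p q := match p, q with
    | none, some (.inl x) => x = u
    | some (.inl x), none => x = u
    | none, some (.inr y) => y = v
    | some (.inr y), none => y = v
    | some (.inl x), some (.inl y) => G.Adj x y
    | some (.inr x), some (.inr y) => H.Adj x y
    | _, _ => False
  symm := ⟨by
    rintro (_ | x | x) (_ | y | y) h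
    all_goals first | exact h | exact SimpleGraph.Adj.symm h⟩
  loopless := ⟨by
    rintro (_ | x | x) h
    · exact h
    · exact G.irrefl h
    · exact H.irrefl h⟩

variable (G : SimpleGraph α) (H : SimpleGraph β) (u : α) (v : β)

/-- The embedding of the first graph into a bridge graph. -/
def bridgeLeft : G ↪g bridgeGraph G H u v where
  toFun x := some (.inl x)
  inj' _ _ h := by simpa using h
  map_rel_iff' := Iff.rfl

/-- The embedding of the second graph into a bridge graph. -/
def bridgeRight : H ↪g bridgeGraph G H u v where
  toFun x := some (.inr x)
  inj' _ _ h := by simpa using h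
  map_rel_iff' := Iff.rfl

variable {G H}

theorem bridgeGraph_connected (hG : G.Connected) (hH : H.Connected) :
    (bridgeGraph G H u v).Connected := by
  have key : ∀ p, (bridgeGraph G H u v).Reachable none p := by
    rintro (_ | x | y)
    · exact SimpleGraph.Reachable.refl _
    · have h : (bridgeGraph G H u v).Adj none (some (.inl u)) := by rfl
      exact h.reachable.trans ((hG.preconnected u x).map (bridgeLeft G H u v).toHom)
    · have h : (bridgeGraph G H u v).Adj none (some (.inr v)) := by rfl
      exact h.reachable.trans ((hH.preconnected v y).map (bridgeRight G H u v).toHom)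
  have : Nonempty (Option (α ⊕ β)) := ⟨none⟩
  exact ⟨fun p q => (key p).symm.trans (key q)⟩

theorem bridgeGraph_isTree [Finite α] [Finite β] (hG : G.IsTree) (hH : H.IsTree) :
    (bridgeGraph G H u v).IsTree := by
  have hconn := bridgeGraph_connected u v hG.connected hH.connected
  rw [SimpleGraph.isTree_iff_connected_and_card] at hG hH ⊢
  refine ⟨hconn, le_antisymm ?_ hconn.card_vert_le_card_edgeSet_add_one⟩
  have hsub : (bridgeGraph G H u v).edgeSet ⊆
      (Sym2.map (bridgeLeft G H u v) '' G.edgeSet ∪ Sym2.map (bridgeRight G H u v) '' H.edgeSet) ∪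
        {s(none, some (.inl u)), s(none, some (.inr v))} := by
    intro e
    induction e with
    | _ p q =>
    rw [SimpleGraph.mem_edgeSet]
    intro h
    rcases p with _ | x | x <;> rcases q with _ | y | y
    · exact h.elim
    · obtain rfl : y = u := h
      exact Or.inr (Or.inl rfl)
    · obtain rfl : y = v := h
      exact Or.inr (Or.inr rfl)
    · obtain rfl : x = u := h
      exact Or.inr (Or.inl Sym2.eq_swap)
    · exact Or.inl (Or.inl ⟨s(x, y), h, rfl⟩)
    · exact h.elim
    · obtain rfl : x = v := h
      exact Or.inr (Or.inr Sym2.eq_swap)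
    · exact h.elim
    · exact Or.inl (Or.inr ⟨s(x, y), h, rfl⟩)
  have h1 := Set.ncard_le_ncard hsub (Set.toFinite _)
  have h2 := Set.ncard_union_le
    (Sym2.map (bridgeLeft G H u v) '' G.edgeSet ∪ Sym2.map (bridgeRight G H u v) '' H.edgeSet)
    {s(none, some (.inl u)), s(none, some (.inr v))}
  have h3 := Set.ncard_union_le (Sym2.map (bridgeLeft G H u v) '' G.edgeSet)
    (Sym2.map (bridgeRight G H u v) '' H.edgeSet)
  have h4 := Set.ncard_image_le (f := Sym2.map (bridgeLeft G H u v)) (Set.toFinite G.edgeSet)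
  have h5 := Set.ncard_image_le (f := Sym2.map (bridgeRight G H u v)) (Set.toFinite H.edgeSet)
  have h6 := Set.ncard_insert_le (s(none, some (.inl u)) : Sym2 (Option (α ⊕ β)))
    {s(none, some (.inr v))}
  rw [Set.ncard_singleton] at h6
  have h7 : Nat.card (Option (α ⊕ β)) = Nat.card α + Nat.card β + 1 := by
    rw [Finite.card_option, Nat.card_sum]
  have h8 := hG.2
  have h9 := hH.2
  rw [Nat.card_coe_set_eq] at h8 h9 ⊢
  omega

end BridgeGraph

theorem connIn_range {α : Type*} {H : SimpleGraph α} {G : SimpleGraph V} (hH : H.Connected)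
    (φ : H ↪g G) : ConnIn G (Set.range φ) := by
  obtain ⟨x⟩ := hH.nonempty
  refine ⟨⟨φ x, x, rfl⟩, ?_⟩
  rintro _ ⟨x, rfl⟩ _ ⟨y, rfl⟩
  obtain ⟨p⟩ := hH.preconnected x y
  refine ⟨p.map φ.toHom, fun v hv => ?_⟩
  rw [SimpleGraph.Walk.support_map, List.mem_map] at hv
  obtain ⟨z, -, rfl⟩ := hv
  exact ⟨z, rfl⟩

theorem ConnIn.union_of_adj {G : SimpleGraph V} {s : Set V} {x y : V} (hs : ConnIn G s)
    (hy : y ∈ s) (h : G.Adj x y) : ConnIn G (insert x s) := by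
  have key : ∀ z ∈ insert x s, ReachIn G (insert x s) y z := by
    rintro z (rfl | hz)
    · exact ReachIn.of_adj h.symm (Or.inr hy) (Or.inl rfl)
    · exact (hs.2 y hy z hz).mono (Set.subset_insert _ _)
  exact ⟨⟨x, Or.inl rfl⟩, fun z hz z' hz' => (key z hz).symm.trans (key z' hz')⟩

/-- Binary trees describing iterated bridge graphs. -/
inductive Shape : Type where
  | leaf : Shape
  | join : Shape → Shape → Shape

namespace Shape

/-- The vertices of the graph of a shape. -/
def Vert : Shape → Type
  | leaf => Unit
  | join a b => Option (a.Vert ⊕ b.Vert)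

instance fintypeVert : (a : Shape) → Fintype a.Vert
  | leaf => inferInstanceAs (Fintype Unit)
  | join a b =>
    let := fintypeVert a
    let := fintypeVert b
    inferInstanceAs (Fintype (Option (a.Vert ⊕ b.Vert)))

/-- The distinguished vertex of a shape. -/
def root : (a : Shape) → a.Vert
  | leaf => ()
  | join a _ => some (.inl a.root)

/-- The tree of a shape: for `join a b`, the trees of `a` and `b` are connected through a new
vertex adjacent to the distinguished vertices of both. -/
def graph : (a : Shape) → SimpleGraph a.Vert
  | leaf => ⊥
  | join a b => bridgeGraph a.graph b.graph a.root b.root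

/-- The weights on a shape, of total weight 1: a connecting vertex gets a fraction `δ` of the
weight, and the rest is split evenly between the two sides. -/
noncomputable def weight (δ : ℝ) : (a : Shape) → a.Vert → ℝ
  | leaf => fun _ => 1
  | join a b => fun p => match p with
    | none => δ
    | some (.inl x) => (1 - δ) / 2 * a.weight δ x
    | some (.inr y) => (1 - δ) / 2 * b.weight δ y

/-- The cost of the centroid tree of a shape. -/
noncomputable def centroidCost (δ : ℝ) : Shape → ℝ
  | leaf => 1
  | join a b => 1 + (1 - δ) / 2 * (a.centroidCost δ + b.centroidCost δ)

/-- A vertex ranking of a shape in which the distinguished vertex comes first. -/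
def rank : (a : Shape) → a.Vert → ℕ
  | leaf => fun _ => 1
  | join a b => fun p => match p with
    | none => 3
    | some (.inl x) => a.rank x
    | some (.inr y) => b.rank y + 1

/-- The cost of the ranking `Shape.rank`. -/
noncomputable def rankCost (δ : ℝ) : Shape → ℝ
  | leaf => 1
  | join a b => (1 - δ) / 2 * a.rankCost δ + 3 * δ + (1 - δ) / 2 * (b.rankCost δ + 1)

theorem isTree : (a : Shape) → a.graph.IsTree
  | leaf =>
    have : Subsingleton leaf.Vert := inferInstanceAs (Subsingleton Unit)
    have : Nonempty leaf.Vert := ⟨leaf.root⟩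
    SimpleGraph.IsTree.of_subsingleton
  | join a b => bridgeGraph_isTree a.root b.root a.isTree b.isTree

/-- The embedding of the left part of a join. -/
def left (a b : Shape) : a.graph ↪g (join a b).graph := bridgeLeft _ _ _ _

/-- The embedding of the right part of a join. -/
def right (a b : Shape) : b.graph ↪g (join a b).graph := bridgeRight _ _ _ _

/-- The connecting vertex of a join. -/
def mid (a b : Shape) : (join a b).Vert := none

variable {a b : Shape}

theorem forall_vert_join {P : (join a b).Vert → Prop} :
    (∀ p, P p) ↔ P (mid a b) ∧ (∀ x, P (left a b x)) ∧ ∀ y, P (right a b y) := by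
  refine ⟨fun h => ⟨h _, fun _ => h _, fun _ => h _⟩, ?_⟩
  rintro ⟨h1, h2, h3⟩ (_ | x | y)
  exacts [h1, h2 x, h3 y]

theorem vert_join_cases (p : (join a b).Vert) :
    p = mid a b ∨ (∃ x, p = left a b x) ∨ ∃ y, p = right a b y := by
  rcases p with _ | x | y
  exacts [Or.inl rfl, Or.inr (Or.inl ⟨x, rfl⟩), Or.inr (Or.inr ⟨y, rfl⟩)]

theorem mid_ne_left (x : a.Vert) : mid a b ≠ left a b x := nofun

theorem mid_ne_right (y : b.Vert) : mid a b ≠ right a b y := nofun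

theorem left_ne_right (x : a.Vert) (y : b.Vert) : left a b x ≠ right a b y := nofun

theorem not_adj_left_right (x : a.Vert) (y : b.Vert) :
    ¬ (join a b).graph.Adj (left a b x) (right a b y) := id

theorem adj_mid_left {x : a.Vert} : (join a b).graph.Adj (mid a b) (left a b x) ↔ x = a.root :=
  Iff.rfl

theorem adj_mid_right {y : b.Vert} : (join a b).graph.Adj (mid a b) (right a b y) ↔ y = b.root :=
  Iff.rfl

theorem sum_leaf (F : leaf.Vert → ℝ) : ∑ p, F p = F leaf.root :=
  Fintype.sum_unique (fun x : Unit => F x)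

theorem sum_join (F : (join a b).Vert → ℝ) :
    ∑ p, F p = F (mid a b) + (∑ x, F (left a b x) + ∑ y, F (right a b y)) := by
  have h := Fintype.sum_option (α := a.Vert ⊕ b.Vert) F
  rw [Fintype.sum_sum_type] at h
  exact h

theorem weight_nonneg {δ : ℝ} (h0 : 0 ≤ δ) (h1 : δ ≤ 1) : (a : Shape) → ∀ x, 0 ≤ a.weight δ x
  | leaf => fun _ => zero_le_one
  | join a b => by
    rw [forall_vert_join]
    exact ⟨h0, fun x => mul_nonneg (by linarith) (a.weight_nonneg h0 h1 x),
      fun y => mul_nonneg (by linarith) (b.weight_nonneg h0 h1 y)⟩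

theorem sum_weight (δ : ℝ) : (a : Shape) → ∑ x, a.weight δ x = 1
  | leaf => sum_leaf _
  | join a b => by
    have h : ∑ p, (join a b).weight δ p =
        δ + (∑ x, (1 - δ) / 2 * a.weight δ x + ∑ y, (1 - δ) / 2 * b.weight δ y) := sum_join _
    rw [h, ← Finset.mul_sum, ← Finset.mul_sum, a.sum_weight δ, b.sum_weight δ]
    ring

theorem sum_weight_mul_rank (δ : ℝ) : (a : Shape) →
    ∑ x, a.weight δ x * (a.rank x : ℝ) = a.rankCost δ
  | leaf => (sum_leaf _).trans (by simp [weight, rank, rankCost])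
  | join a b => by
    have h : ∑ p, (join a b).weight δ p * ((join a b).rank p : ℝ) =
        δ * ((3 : ℕ) : ℝ) + (∑ x, (1 - δ) / 2 * a.weight δ x * (a.rank x : ℝ) +
          ∑ y, (1 - δ) / 2 * b.weight δ y * ((b.rank y + 1 : ℕ) : ℝ)) := sum_join _
    have hb : ∑ y, (1 - δ) / 2 * b.weight δ y * ((b.rank y + 1 : ℕ) : ℝ) =
        (1 - δ) / 2 * (b.rankCost δ + 1) := by
      rw [← b.sum_weight_mul_rank δ]
      nth_rewrite 3 [← b.sum_weight δ]
      rw [← Finset.sum_add_distrib, Finset.mul_sum]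
      exact Finset.sum_congr rfl fun y _ => by push_cast; ring
    have ha : ∑ x, (1 - δ) / 2 * a.weight δ x * (a.rank x : ℝ) = (1 - δ) / 2 * a.rankCost δ := by
      rw [← a.sum_weight_mul_rank δ, Finset.mul_sum]
      exact Finset.sum_congr rfl fun y _ => by ring
    rw [h, ha, hb, rankCost]
    push_cast
    ring

end Shape

theorem wsum_mono {w : V → ℝ} {A B : Set V} (hB : B.Finite) (hAB : A ⊆ B)
    (h0 : ∀ x ∈ B, 0 ≤ w x) : wsum w A ≤ wsum w B := by
  rw [wsum, wsum, finsum_mem_eq_finite_toFinset_sum _ hB,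
    finsum_mem_eq_finite_toFinset_sum _ (hB.subset hAB)]
  refine Finset.sum_le_sum_of_subset_of_nonneg ?_ fun x hx _ => h0 x (by simpa using hx)
  simpa using hAB

theorem wsum_range {α : Type*} [Fintype α] {w : V → ℝ} {φ : α → V} (hφ : Function.Injective φ) :
    wsum w (Set.range φ) = ∑ x, w (φ x) := by
  rw [wsum, finsum_mem_range hφ, finsum_eq_sum_of_fintype]

theorem IsCentroidTree.exists_child {G : SimpleGraph V} {w : V → ℝ} {s : Set V} {r x : V}
    {ts : List (RTree V)} (h : IsCentroidTree G w s (RTree.node r ts)) (hx : x ∈ s \ {r}) :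
    ∃ t, IsCentroidTree G w (compIn G (s \ {r}) x) t ∧
      ∀ y ∈ compIn G (s \ {r}) x, (RTree.node r ts).depth y = t.depth y + 1 := by
  obtain ⟨t, ht, htt, hd⟩ := h.1.exists_child hx
  exact ⟨t, ⟨htt, fun t' ht' => h.2 t' (RTree.mem_allSubtrees_node.2 (Or.inr ⟨t, ht, ht'⟩))⟩, hd⟩

namespace Shape

variable {G : SimpleGraph V} {a b : Shape}

theorem range_left_subset (φ : (join a b).graph ↪g G) :
    Set.range ((left a b).trans φ) ⊆ Set.range φ := by
  rintro _ ⟨x, rfl⟩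
  exact ⟨_, rfl⟩

theorem range_right_subset (φ : (join a b).graph ↪g G) :
    Set.range ((right a b).trans φ) ⊆ Set.range φ := by
  rintro _ ⟨x, rfl⟩
  exact ⟨_, rfl⟩

theorem compIn_left (φ : (join a b).graph ↪g G) (x : a.Vert) :
    compIn G (Set.range φ \ {φ (mid a b)}) (φ (left a b x)) =
      Set.range ((left a b).trans φ) := by
  refine compIn_eq_of_closed (connIn_range a.isTree.connected _) ?_ ?_ ⟨x, rfl⟩
  · rintro _ ⟨x, rfl⟩
    exact ⟨⟨_, rfl⟩, fun h => mid_ne_left x (φ.injective h).symm⟩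
  · rintro _ - _ ⟨⟨q, rfl⟩, hq⟩ hadj ⟨x, rfl⟩
    obtain rfl | ⟨y, rfl⟩ | ⟨y, rfl⟩ := vert_join_cases q
    · exact absurd rfl hq
    · exact ⟨y, rfl⟩
    · exact absurd (φ.map_rel_iff.1 hadj) (not_adj_left_right x y)

theorem compIn_right (φ : (join a b).graph ↪g G) (x : b.Vert) :
    compIn G (Set.range φ \ {φ (mid a b)}) (φ (right a b x)) =
      Set.range ((right a b).trans φ) := by
  refine compIn_eq_of_closed (connIn_range b.isTree.connected _) ?_ ?_ ⟨x, rfl⟩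
  · rintro _ ⟨x, rfl⟩
    exact ⟨⟨_, rfl⟩, fun h => mid_ne_right x (φ.injective h).symm⟩
  · rintro _ - _ ⟨⟨q, rfl⟩, hq⟩ hadj ⟨x, rfl⟩
    obtain rfl | ⟨y, rfl⟩ | ⟨y, rfl⟩ := vert_join_cases q
    · exact absurd rfl hq
    · exact absurd (φ.map_rel_iff.1 hadj).symm (not_adj_left_right y x)
    · exact ⟨y, rfl⟩

/-- A vertex whose removal leaves the connecting vertex attached to a copy of a part of weight
`(1 - δ) / 2` is not a centroid. -/
theorem not_isCentroid_of_adj_mid {δ : ℝ} (h0 : 0 < δ) {w : V → ℝ} {s : Set V} (hs : s.Finite)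
    (hw0 : ∀ x ∈ s, 0 ≤ w x) {c : ℝ} (hc : 0 < c) (hsw : wsum w s = c)
    {d : Shape} (ψ : d.graph ↪g G) (hψ : ∀ x, w (ψ x) = c * ((1 - δ) / 2) * d.weight δ x)
    {m : V} (hm : w m = c * δ) (hms : m ∈ s) (hψs : Set.range ψ ⊆ s) (hadj : G.Adj m (ψ d.root))
    (hmψ : m ∉ Set.range ψ) {r : V} (hrm : r ≠ m) (hr : r ∉ Set.range ψ) :
    ¬ IsCentroid G w s r := by
  intro hcent
  have hconn : ConnIn G (insert m (Set.range ψ)) :=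
    (connIn_range d.isTree.connected ψ).union_of_adj ⟨d.root, rfl⟩ hadj
  have hsub : insert m (Set.range ψ) ⊆ s \ {r} := by
    rintro y (rfl | hy)
    · exact ⟨hms, hrm.symm⟩
    · exact ⟨hψs hy, fun h => hr (h ▸ hy)⟩
  have h1 := hcent.2 m (hsub (Or.inl rfl))
  have hcs : compIn G (s \ {r}) m ⊆ s := compIn_subset.trans Set.sdiff_subset
  have h2 := wsum_mono (hs.subset hcs) (hconn.subset_compIn hsub (Or.inl rfl))
    fun x hx => hw0 x (hcs hx)
  have h3 : wsum w (insert m (Set.range ψ)) = c * δ + c * ((1 - δ) / 2) := by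
    have h4 : wsum w (Set.range ψ) = c * ((1 - δ) / 2) := by
      rw [wsum_range ψ.injective]
      simp only [hψ]
      rw [← Finset.mul_sum, d.sum_weight, mul_one]
    rw [← h4, ← hm]
    exact finsum_mem_insert _ hmψ (Set.toFinite _)
  have := mul_pos hc h0
  rw [hsw] at h1
  linarith

theorem centroidCost_le {δ : ℝ} (h0 : 0 < δ) (h1 : δ < 1) {w : V → ℝ} (a : Shape) :
    ∀ (φ : a.graph ↪g G) {c : ℝ}, 0 < c → (∀ x, w (φ x) = c * a.weight δ x) →
      ∀ T, IsCentroidTree G w (Set.range φ) T →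
        c * a.centroidCost δ ≤ ∑ x, w (φ x) * (T.depth (φ x) : ℝ) := by
  induction a with
  | leaf =>
    intro φ c hc hw T hT
    rw [sum_leaf, hw]
    have : (1 : ℝ) ≤ T.depth (φ leaf.root) := by
      exact_mod_cast hT.1.one_le_depth ⟨_, rfl⟩
    show c * 1 ≤ c * 1 * _
    nlinarith
  | join a b iha ihb =>
    intro φ c hc hw T hT
    have hβ : 0 < (1 - δ) / 2 := by linarith
    have hwm : w (φ (mid a b)) = c * δ := hw _
    have hwl : ∀ x, w (φ (left a b x)) = c * ((1 - δ) / 2) * a.weight δ x := fun x =>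
      (hw _).trans (mul_assoc _ _ _).symm
    have hwr : ∀ x, w (φ (right a b x)) = c * ((1 - δ) / 2) * b.weight δ x := fun x =>
      (hw _).trans (mul_assoc _ _ _).symm
    have hw0 : ∀ x ∈ Set.range φ, 0 ≤ w x := by
      rintro _ ⟨x, rfl⟩
      rw [hw]
      exact mul_nonneg hc.le (weight_nonneg h0.le h1.le _ x)
    have hsw : wsum w (Set.range φ) = c := by
      rw [wsum_range φ.injective]
      simp only [hw]
      rw [← Finset.mul_sum, sum_weight, mul_one]
    obtain ⟨r, ts⟩ := T
    have hcent : IsCentroid G w (Set.range φ) r := by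
      have := hT.2 _ (RTree.mem_allSubtrees_self _)
      rwa [hT.1.vertSet_eq] at this
    obtain rfl : r = φ (mid a b) := by
      obtain ⟨p, rfl⟩ := hcent.1
      obtain rfl | ⟨x, rfl⟩ | ⟨x, rfl⟩ := vert_join_cases p
      · rfl
      · refine absurd hcent (not_isCentroid_of_adj_mid h0 (Set.toFinite _) hw0 hc hsw
          ((right a b).trans φ) hwr hwm ⟨_, rfl⟩ (range_right_subset φ)
          (φ.map_rel_iff.2 (adj_mid_right.2 rfl)) ?_ ?_ ?_)
        · rintro ⟨y, hy⟩
          exact mid_ne_right y (φ.injective hy).symm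
        · exact fun h => mid_ne_left x (φ.injective h).symm
        · rintro ⟨y, hy⟩
          exact left_ne_right x y (φ.injective hy).symm
      · refine absurd hcent (not_isCentroid_of_adj_mid h0 (Set.toFinite _) hw0 hc hsw
          ((left a b).trans φ) hwl hwm ⟨_, rfl⟩ (range_left_subset φ)
          (φ.map_rel_iff.2 (adj_mid_left.2 rfl)) ?_ ?_ ?_)
        · rintro ⟨y, hy⟩
          exact mid_ne_left y (φ.injective hy).symm
        · exact fun h => mid_ne_right x (φ.injective h).symm
        · rintro ⟨y, hy⟩
          exact left_ne_right y x (φ.injective hy)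
    obtain ⟨ta, hta, hda⟩ := hT.exists_child (x := φ (left a b a.root))
      ⟨⟨_, rfl⟩, fun h => mid_ne_left a.root (φ.injective h).symm⟩
    obtain ⟨tb, htb, hdb⟩ := hT.exists_child (x := φ (right a b b.root))
      ⟨⟨_, rfl⟩, fun h => mid_ne_right b.root (φ.injective h).symm⟩
    rw [compIn_left] at hta hda
    rw [compIn_right] at htb hdb
    have ha := iha ((left a b).trans φ) (mul_pos hc hβ) hwl ta hta
    have hb := ihb ((right a b).trans φ) (mul_pos hc hβ) hwr tb htb
    have hsa : ∑ x, w (φ (left a b x)) *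
          ((RTree.node (φ (mid a b)) ts).depth (φ (left a b x)) : ℝ) =
        ∑ x, w (φ (left a b x)) * (ta.depth (φ (left a b x)) : ℝ) + c * ((1 - δ) / 2) := by
      have hsum : ∑ x, c * ((1 - δ) / 2) * a.weight δ x = c * ((1 - δ) / 2) := by
        rw [← Finset.mul_sum, a.sum_weight, mul_one]
      rw [← hsum, ← Finset.sum_add_distrib]
      refine Finset.sum_congr rfl fun x _ => ?_
      have hd : (RTree.node (φ (mid a b)) ts).depth (φ (left a b x)) =
          ta.depth (φ (left a b x)) + 1 := hda _ ⟨x, rfl⟩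
      rw [hd, hwl]
      push_cast
      ring
    have hsb : ∑ x, w (φ (right a b x)) *
          ((RTree.node (φ (mid a b)) ts).depth (φ (right a b x)) : ℝ) =
        ∑ x, w (φ (right a b x)) * (tb.depth (φ (right a b x)) : ℝ) + c * ((1 - δ) / 2) := by
      have hsum : ∑ x, c * ((1 - δ) / 2) * b.weight δ x = c * ((1 - δ) / 2) := by
        rw [← Finset.mul_sum, b.sum_weight, mul_one]
      rw [← hsum, ← Finset.sum_add_distrib]
      refine Finset.sum_congr rfl fun x _ => ?_
      have hd : (RTree.node (φ (mid a b)) ts).depth (φ (right a b x)) =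
          tb.depth (φ (right a b x)) + 1 := hdb _ ⟨x, rfl⟩
      rw [hd, hwr]
      push_cast
      ring
    rw [sum_join, hsa, hsb, hT.1.depth_root, hwm, centroidCost]
    simp only [RelEmbedding.coe_trans, Function.comp_apply] at ha hb
    push_cast
    linarith

theorem le_sum_weight_mul_of_isRanking {δ : ℝ} (h0 : 0 ≤ δ) (h1 : δ ≤ 1) (a : Shape) :
    ∀ (φ : a.graph ↪g G) (f : V → ℕ), IsRanking G (Set.range φ) f → (∀ x, 1 ≤ f (φ x)) →
      (a.centroidCost δ + 1) / 2 ≤ ∑ x, a.weight δ x * (f (φ x) : ℝ) := by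
  induction a with
  | leaf =>
    intro φ f hf hf1
    rw [sum_leaf]
    have : (1 : ℝ) ≤ f (φ leaf.root) := by exact_mod_cast hf1 _
    show ((1 : ℝ) + 1) / 2 ≤ 1 * _
    linarith
  | join a b iha ihb =>
    intro φ f hf hf1
    have hβ : 0 ≤ (1 - δ) / 2 := by linarith
    have hl := hf.mono (range_left_subset φ)
    have hr := hf.mono (range_right_subset φ)
    have ha := iha _ _ hl fun x => hf1 _
    have hb := ihb _ _ hr fun x => hf1 _
    have hpred : ∀ (d : Shape) (ψ : d.graph ↪g G), (∀ x, 2 ≤ f (ψ x)) →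
        ∑ x, d.weight δ x * (f (ψ x) : ℝ) =
          ∑ x, d.weight δ x * ((f (ψ x) - 1 : ℕ) : ℝ) + 1 := by
      intro d ψ h2
      rw [← add_right_inj (-∑ x, d.weight δ x * ((f (ψ x) - 1 : ℕ) : ℝ)), neg_add_cancel_left,
        ← d.sum_weight δ, neg_add_eq_sub, ← Finset.sum_sub_distrib]
      refine Finset.sum_congr rfl fun x _ => ?_
      have := h2 x
      rw [Nat.cast_sub (by omega)]
      push_cast
      ring
    have hm : (1 : ℝ) ≤ f (φ (mid a b)) := by exact_mod_cast hf1 _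
    have hsum : ∑ p, (join a b).weight δ p * (f (φ p) : ℝ) = δ * f (φ (mid a b)) +
        ((1 - δ) / 2 * ∑ x, a.weight δ x * (f (φ (left a b x)) : ℝ) +
          (1 - δ) / 2 * ∑ x, b.weight δ x * (f (φ (right a b x)) : ℝ)) := by
      rw [sum_join, Finset.mul_sum, Finset.mul_sum]
      simp only [← mul_assoc]
      rfl
    simp only [RelEmbedding.coe_trans, Function.comp_apply] at ha hb
    have hδ := mul_le_mul_of_nonneg_left hm h0
    have hor : (∀ x, 2 ≤ f (φ (left a b x))) ∨ ∀ y, 2 ≤ f (φ (right a b y)) := by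
      obtain ⟨_, ⟨p, rfl⟩, hmin⟩ := hf _ subset_rfl (connIn_range (join a b).isTree.connected φ)
      have h2 : ∀ q, q ≠ p → 2 ≤ f (φ q) := fun q hq => by
        have := hmin _ ⟨q, rfl⟩ (fun h => hq (φ.injective h))
        have := hf1 p
        omega
      obtain rfl | ⟨x, rfl⟩ | ⟨x, rfl⟩ := vert_join_cases p
      · exact Or.inl fun x => h2 _ (mid_ne_left x).symm
      · exact Or.inr fun y => h2 _ (left_ne_right x y).symm
      · exact Or.inl fun y => h2 _ (left_ne_right y x)
    rw [hsum, centroidCost]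
    rcases hor with h2 | h2
    · have ha' := iha _ _ (hl.pred fun _ ⟨x, hx⟩ => hx ▸ hf1 _) fun x => Nat.le_sub_one_of_lt (h2 x)
      have he := hpred a ((left a b).trans φ) h2
      simp only [RelEmbedding.coe_trans, Function.comp_apply] at ha' he
      rw [he]
      have := mul_le_mul_of_nonneg_left ha' hβ
      have := mul_le_mul_of_nonneg_left hb hβ
      linarith
    · have hb' := ihb _ _ (hr.pred fun _ ⟨x, hx⟩ => hx ▸ hf1 _) fun x => Nat.le_sub_one_of_lt (h2 x)
      have he := hpred b ((right a b).trans φ) h2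
      simp only [RelEmbedding.coe_trans, Function.comp_apply] at hb' he
      rw [he]
      have := mul_le_mul_of_nonneg_left hb' hβ
      have := mul_le_mul_of_nonneg_left ha hβ
      linarith

theorem rank_root : (a : Shape) → a.rank a.root = 1
  | leaf => rfl
  | join a _ => a.rank_root

theorem one_le_rank : (a : Shape) → ∀ x, 1 ≤ a.rank x
  | leaf => fun _ => le_rfl
  | join a b => by
    rw [forall_vert_join]
    exact ⟨Nat.le_add_left 1 2, a.one_le_rank, fun y => Nat.le_add_left _ _⟩

theorem two_le_rank_of_ne_root : (a : Shape) → ∀ x, x ≠ a.root → 2 ≤ a.rank x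
  | leaf => fun x hx => absurd (Subsingleton.elim (α := Unit) x _) hx
  | join a b => by
    rw [forall_vert_join]
    refine ⟨fun _ => Nat.le_succ 2, fun x hx => a.two_le_rank_of_ne_root x fun h => hx ?_,
      fun y _ => Nat.succ_le_succ (b.one_le_rank y)⟩
    rw [h]
    rfl

theorem exists_min_rank (a : Shape) : ∀ (φ : a.graph ↪g G) (S : Set a.Vert),
    ConnIn G (φ '' S) → ∃ x ∈ S, ∀ y ∈ S, y ≠ x → a.rank x < a.rank y := by
  induction a with
  | leaf =>
    rintro φ S ⟨⟨_, x, hx, rfl⟩, -⟩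
    exact ⟨x, hx, fun y _ hyx => absurd (Subsingleton.elim (α := Unit) y x) hyx⟩
  | join a b iha ihb =>
    intro φ S hS
    by_cases hroot : (join a b).root ∈ S
    · refine ⟨_, hroot, fun y _ hy => ?_⟩
      rw [rank_root]
      exact two_le_rank_of_ne_root _ y hy
    by_cases hleft : ∃ x, left a b x ∈ S
    · obtain ⟨x, hx⟩ := hleft
      have hsub : φ '' S ⊆ Set.range ((left a b).trans φ) := by
        refine hS.subset_of_closed ?_ ⟨_, hx, rfl⟩ ⟨x, rfl⟩
        rintro _ hz _ ⟨q, hq, rfl⟩ hadj ⟨z, rfl⟩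
        obtain rfl | ⟨y, rfl⟩ | ⟨y, rfl⟩ := vert_join_cases q
        · obtain rfl := adj_mid_left.1 (φ.map_rel_iff.1 hadj).symm
          obtain ⟨p, hp, hpz⟩ := hz
          obtain rfl := φ.injective hpz
          exact absurd hp hroot
        · exact ⟨y, rfl⟩
        · exact absurd (φ.map_rel_iff.1 hadj) (not_adj_left_right z y)
      have hmem : ∀ p ∈ S, ∃ y, left a b y = p := fun p hp => by
        obtain ⟨y, hy⟩ := hsub ⟨p, hp, rfl⟩
        exact ⟨y, φ.injective hy⟩
      have himg : ((left a b).trans φ) '' (left a b ⁻¹' S) = φ '' S := by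
        ext z
        constructor
        · rintro ⟨y, hy, rfl⟩
          exact ⟨_, hy, rfl⟩
        · rintro ⟨p, hp, rfl⟩
          obtain ⟨y, rfl⟩ := hmem p hp
          exact ⟨y, hp, rfl⟩
      obtain ⟨y, hy, hmin⟩ := iha ((left a b).trans φ) (left a b ⁻¹' S) (himg ▸ hS)
      refine ⟨left a b y, hy, fun p hp hne => ?_⟩
      obtain ⟨z, rfl⟩ := hmem p hp
      exact hmin z hp fun h => hne (h ▸ rfl)
    · push Not at hleft
      by_cases hmid : mid a b ∈ S
      · by_cases hrroot : right a b b.root ∈ S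
        · refine ⟨_, hrroot, fun p hp hne => ?_⟩
          have hr : (join a b).rank (right a b b.root) = 2 := congrArg (· + 1) b.rank_root
          rw [hr]
          obtain rfl | ⟨y, rfl⟩ | ⟨y, rfl⟩ := vert_join_cases p
          · exact Nat.lt_succ_self 2
          · exact absurd hp (hleft y)
          · exact Nat.succ_lt_succ (b.two_le_rank_of_ne_root y fun h => hne (h ▸ rfl))
        · refine ⟨_, hmid, fun p hp hne => ?_⟩
          have hsub : φ '' S ⊆ {φ (mid a b)} := by
            refine hS.subset_of_closed ?_ ⟨_, hmid, rfl⟩ rfl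
            rintro _ - _ ⟨q, hq, rfl⟩ hadj rfl
            obtain rfl | ⟨y, rfl⟩ | ⟨y, rfl⟩ := vert_join_cases q
            · rfl
            · exact absurd hq (hleft y)
            · obtain rfl := adj_mid_right.1 (φ.map_rel_iff.1 hadj)
              exact absurd hq hrroot
          exact absurd (φ.injective (hsub ⟨p, hp, rfl⟩)) hne
      · have hmem : ∀ p ∈ S, ∃ y, right a b y = p := fun p hp => by
          obtain rfl | ⟨y, rfl⟩ | ⟨y, rfl⟩ := vert_join_cases p
          · exact absurd hp hmid
          · exact absurd hp (hleft y)
          · exact ⟨y, rfl⟩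
        have himg : ((right a b).trans φ) '' (right a b ⁻¹' S) = φ '' S := by
          ext z
          constructor
          · rintro ⟨y, hy, rfl⟩
            exact ⟨_, hy, rfl⟩
          · rintro ⟨p, hp, rfl⟩
            obtain ⟨y, rfl⟩ := hmem p hp
            exact ⟨y, hp, rfl⟩
        obtain ⟨y, hy, hmin⟩ := ihb ((right a b).trans φ) (right a b ⁻¹' S) (himg ▸ hS)
        refine ⟨right a b y, hy, fun p hp hne => ?_⟩
        obtain ⟨z, rfl⟩ := hmem p hp
        exact Nat.succ_lt_succ (hmin z hp fun h => hne (h ▸ rfl))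

theorem isRanking_rank (a : Shape) : IsRanking a.graph Set.univ a.rank := by
  intro S _ hS
  refine a.exists_min_rank (SimpleGraph.Embedding.refl) S ?_
  have himg : (SimpleGraph.Embedding.refl : a.graph ↪g a.graph) '' S = S := Set.image_id S
  rwa [himg]

theorem range_refl (a : Shape) :
    Set.range (SimpleGraph.Embedding.refl : a.graph ↪g a.graph) = Set.univ :=
  Set.range_id

theorem connIn_univ (a : Shape) : ConnIn a.graph Set.univ := by
  rw [← a.range_refl]
  exact connIn_range a.isTree.connected _

theorem cost_eq_sum {a : Shape} {w : a.Vert → ℝ} {T : RTree a.Vert}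
    (hT : IsSearchTree a.graph Set.univ T) : cost w T = ∑ x, w x * (T.depth x : ℝ) := by
  rw [cost, hT.vertSet_eq, finsum_mem_univ, finsum_eq_sum_of_fintype]

theorem exists_searchTree_cost_le {δ : ℝ} (h0 : 0 ≤ δ) (h1 : δ ≤ 1) (a : Shape) :
    ∃ T, IsSearchTree a.graph Set.univ T ∧ cost (a.weight δ) T ≤ a.rankCost δ := by
  obtain ⟨T, hT, hd⟩ := a.isRanking_rank.exists_isSearchTree Set.finite_univ a.connIn_univ
    fun x _ => a.one_le_rank x
  refine ⟨T, hT, ?_⟩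
  rw [cost_eq_sum hT, ← sum_weight_mul_rank]
  gcongr with x
  · exact weight_nonneg h0 h1 a x
  · exact hd x trivial

theorem le_cost_of_isSearchTree {δ : ℝ} (h0 : 0 ≤ δ) (h1 : δ ≤ 1) {a : Shape} {T : RTree a.Vert}
    (hT : IsSearchTree a.graph Set.univ T) :
    (a.centroidCost δ + 1) / 2 ≤ cost (a.weight δ) T := by
  rw [cost_eq_sum hT]
  refine a.le_sum_weight_mul_of_isRanking h0 h1 SimpleGraph.Embedding.refl T.depth ?_ fun x =>
    hT.one_le_depth trivial
  rw [range_refl]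
  exact hT.isRanking_depth

theorem OPT_le_rankCost {δ : ℝ} (h0 : 0 ≤ δ) (h1 : δ ≤ 1) (a : Shape) :
    OPT a.graph (a.weight δ) Set.univ ≤ a.rankCost δ := by
  obtain ⟨T, hT, hc⟩ := a.exists_searchTree_cost_le h0 h1
  have hb : BddBelow (cost (a.weight δ) '' {T | IsSearchTree a.graph Set.univ T}) := by
    refine ⟨(a.centroidCost δ + 1) / 2, ?_⟩
    rintro _ ⟨T', hT', rfl⟩
    exact le_cost_of_isSearchTree h0 h1 hT'
  exact (csInf_le hb ⟨T, hT, rfl⟩).trans hc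

theorem le_OPT {δ : ℝ} (h0 : 0 ≤ δ) (h1 : δ ≤ 1) (a : Shape) :
    (a.centroidCost δ + 1) / 2 ≤ OPT a.graph (a.weight δ) Set.univ := by
  obtain ⟨T, hT, -⟩ := a.exists_searchTree_cost_le h0 h1
  refine le_csInf ⟨_, T, hT, rfl⟩ ?_
  rintro _ ⟨T', hT', rfl⟩
  exact le_cost_of_isSearchTree h0 h1 hT'

theorem centroidCost_le_cost {δ : ℝ} (h0 : 0 < δ) (h1 : δ < 1) {a : Shape} {T : RTree a.Vert}
    (hT : IsCentroidTree a.graph (a.weight δ) Set.univ T) :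
    a.centroidCost δ ≤ cost (a.weight δ) T := by
  rw [cost_eq_sum hT.1, ← one_mul (a.centroidCost δ)]
  refine a.centroidCost_le h0 h1 SimpleGraph.Embedding.refl one_pos (fun x => (one_mul _).symm) T ?_
  rwa [range_refl]

/-- `comb t k` is a single vertex with `k` copies of `t` joined to it one after the other. -/
def comb (t : Shape) : ℕ → Shape
  | 0 => leaf
  | k + 1 => join (comb t k) t

/-- The `d`-fold iteration of `fun t => comb t k`. -/
def iterComb (k : ℕ) : ℕ → Shape
  | 0 => leaf
  | d + 1 => comb (iterComb k d) k

theorem neg_le_centroidCost_sub_comb {δ D : ℝ} (h0 : 0 ≤ δ) (h1 : δ ≤ 1) (hD : 0 ≤ D) {t : Shape}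
    (ht : -D ≤ t.centroidCost δ - 2 * t.rankCost δ + 1) (k : ℕ) :
    -(D + 8 * δ) ≤ (comb t k).centroidCost δ - 2 * (comb t k).rankCost δ + 1 := by
  induction k with
  | zero =>
    simp only [comb, centroidCost, rankCost]
    linarith
  | succ k ih =>
    simp only [comb, centroidCost, rankCost]
    have := mul_le_mul_of_nonneg_left (add_le_add ih ht) (show 0 ≤ (1 - δ) / 2 by linarith)
    nlinarith [mul_nonneg h0 hD, mul_nonneg h0 h0]

theorem neg_le_centroidCost_sub_iterComb {δ : ℝ} (h0 : 0 ≤ δ) (h1 : δ ≤ 1) (k d : ℕ) :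
    -(8 * δ * d) ≤ (iterComb k d).centroidCost δ - 2 * (iterComb k d).rankCost δ + 1 := by
  induction d with
  | zero => simp [iterComb, centroidCost, rankCost]; norm_num
  | succ d ih =>
    have := neg_le_centroidCost_sub_comb h0 h1 (by positivity) ih k
    push_cast
    rw [iterComb]
    linarith

theorem le_centroidCost_comb {δ X : ℝ} (h0 : 0 ≤ δ) (h1 : δ ≤ 1) (hX : 0 ≤ X)
    (hδ : δ * (2 * X + 1) ≤ 1) {t : Shape} (ht : X ≤ t.centroidCost δ) (k : ℕ) :
    X + 1 - (X + 1) * (1 / 2) ^ k ≤ (comb t k).centroidCost δ := by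
  induction k with
  | zero => simp [comb, centroidCost]
  | succ k ih =>
    simp only [comb, centroidCost]
    have := mul_le_mul_of_nonneg_left (add_le_add ih ht) (show 0 ≤ (1 - δ) / 2 by linarith)
    have hp : 0 ≤ δ * ((X + 1) * (1 / 2) ^ k) := by positivity
    rw [pow_succ]
    nlinarith

theorem le_centroidCost_iterComb {δ : ℝ} (n : ℕ) (h0 : 0 ≤ δ) (hδ : δ * (n + 3) ≤ 1) {d : ℕ}
    (hd : d ≤ n) : 1 + (d : ℝ) / 2 ≤ (iterComb (n + 4) d).centroidCost δ := by
  induction d with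
  | zero => simp [iterComb, centroidCost]
  | succ d ih =>
    have hdn : (d : ℝ) ≤ n := by exact_mod_cast (Nat.le_succ d).trans hd
    have hn : (0 : ℝ) ≤ n := n.cast_nonneg
    have h1 : δ ≤ 1 := by nlinarith
    have := le_centroidCost_comb h0 h1 (X := 1 + (d : ℝ) / 2) (by positivity) (by nlinarith)
      (ih (by omega)) (n + 4)
    have hpow : ((n + 4 : ℕ) : ℝ) ≤ 2 ^ (n + 4) := by
      exact_mod_cast Nat.lt_two_pow_self.le
    have hhalf : (1 + (d : ℝ) / 2 + 1) * (1 / 2) ^ (n + 4) ≤ 1 / 2 := by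
      rw [one_div_pow, mul_one_div, div_le_iff₀ (by positivity)]
      push_cast at hpow
      linarith
    rw [iterComb]
    push_cast
    linarith

end Shape

theorem lower_bound_weighted (ε : ℝ) (hε : 0 < ε) :
    ∃ (V : ℕ → Type) (_ : ∀ n, Fintype (V n)) (G : ∀ n, SimpleGraph (V n))
      (w : ∀ n, V n → ℝ),
      (∀ n, (G n).IsTree) ∧
      (∀ n x, 0 ≤ w n x) ∧
      (∀ n, wsum (w n) Set.univ = 1) ∧
      Filter.Tendsto (fun n => OPT (G n) (w n) Set.univ) Filter.atTop Filter.atTop ∧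
      (∀ n, ∀ C : RTree (V n), IsCentroidTree (G n) (w n) Set.univ C →
        cost (w n) C ≥ 2 * OPT (G n) (w n) Set.univ - 1 - ε) := by
  let δ : ℕ → ℝ := fun n => min ε 1 / (8 * (n + 3))
  have hε1 : 0 < min ε 1 := lt_min hε one_pos
  have hδ0 : ∀ n, 0 < δ n := fun n => by positivity
  have hδmul : ∀ n, 8 * δ n * (n + 3) = min ε 1 := fun n => by
    simp only [δ]
    field_simp
  have hδ1 : ∀ n, δ n < 1 := fun n => by
    have hn : (0 : ℝ) ≤ n := n.cast_nonneg
    nlinarith [hδmul n, hδ0 n, min_le_right ε 1]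
  refine ⟨fun n => (Shape.iterComb (n + 4) n).Vert, fun n => inferInstance,
    fun n => (Shape.iterComb (n + 4) n).graph, fun n => (Shape.iterComb (n + 4) n).weight (δ n),
    fun n => Shape.isTree _, fun n => Shape.weight_nonneg (hδ0 n).le (hδ1 n).le _, fun n => ?_,
    ?_, fun n C hC => ?_⟩
  · rw [wsum, finsum_mem_univ, finsum_eq_sum_of_fintype, Shape.sum_weight]
  · have hlim : Tendsto (fun n : ℕ => (n : ℝ) / 4) atTop atTop :=
      tendsto_natCast_atTop_atTop.atTop_div_const (by norm_num)
    refine tendsto_atTop_mono (fun n => ?_) hlim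
    have h1 := Shape.le_OPT (hδ0 n).le (hδ1 n).le (Shape.iterComb (n + 4) n)
    have h2 := Shape.le_centroidCost_iterComb n (hδ0 n).le
      (by nlinarith [hδmul n, hδ0 n, min_le_right ε 1]) le_rfl
    linarith
  · have h1 := Shape.centroidCost_le_cost (hδ0 n) (hδ1 n) hC
    have h2 := Shape.OPT_le_rankCost (hδ0 n).le (hδ1 n).le (Shape.iterComb (n + 4) n)
    have h3 := Shape.neg_le_centroidCost_sub_iterComb (hδ0 n).le (hδ1 n).le (n + 4) n
    have h4 := hδmul n
    have h5 := hδ0 n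
    have h6 := min_le_left ε 1
    linarith
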